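/- arXiv:1108.5288 — 2 statements merged into one kernel-verified Lean document; each statement's English description precedes it below -/
import Mathlib

section
/- Define F : {0,1}⁴ → ℝ>0 by F(x) = 4 if x₁+x₂+x₃+x₄ = 4, F(x) = 2 if x₁+x₂+x₃+x₄ = 3, and F(x) = 1 otherwise. Then F is log-supermodular, but the Fourier coefficient of F⋆ = F·F̄ at (1,1,1,1) equals −1/8 < 0; consequently ⟨LSM₂⟩_ω is strictly contained in ⟨LSM₄⟩_ω. -/
open scoped NNReal BigOperators

/-- Functions of arity `n` on the Boolean domain with values in `R`. -/
abbrev FnOn (R : Type) (n : ℕ) : Type := (Fin n → Bool) → R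

/-- Functions of all arities on the Boolean domain with values in `R`. -/
abbrev Fn (R : Type) : Type := Σ n : ℕ, FnOn R n

/-- The binary equality function: `EQ(x,x) = 1`, `EQ(x,y) = 0` for `x ≠ y`. -/
def EQfn (R : Type) [CommSemiring R] : Fn R :=
  ⟨2, fun x => if x 0 = x 1 then 1 else 0⟩

/-- `F` (of arity `n`) is representable by a pps-formula over `𝓕`: there are `m` bound
variables and `s` atomic formulas, the `j`-th atomic formula applying `G j ∈ 𝓕` to a
scope `σ j` of (possibly repeated) variables among the `n + m` variables; `F x` is the
sum over all Boolean assignments of the bound variables of the product of the values of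
the atomic formulas. -/
def PpsRep (R : Type) [CommSemiring R] (𝓕 : Set (Fn R)) {n : ℕ} (F : FnOn R n) : Prop :=
  ∃ (m s : ℕ) (G : Fin s → Fn R) (σ : (j : Fin s) → Fin (G j).1 → Fin (n + m)),
    (∀ j, G j ∈ 𝓕) ∧
    ∀ x : Fin n → Bool,
      F x = ∑ y : Fin m → Bool, ∏ j : Fin s, (G j).2 (fun i => Fin.append x y (σ j i))

/-- The functional clone `⟨𝓕⟩` generated by `𝓕`: all functions representable by a
pps-formula over `𝓕 ∪ {EQ}`. -/
def Clone (R : Type) [CommSemiring R] (𝓕 : Set (Fn R)) : Set (Fn R) :=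
  {F | PpsRep R (𝓕 ∪ {EQfn R}) F.2}

/-- The pps_ω-definable functional clone `⟨𝓕⟩_ω`: all functions `F` such that for some
finite `S ⊆ 𝓕 ∪ {EQ}` and every `ε > 0`, some function of the same arity representable
by a pps-formula over `S` is within `ε` of `F` in the sup norm. -/
def CloneOmega (R : Type) [CommSemiring R] [MetricSpace R] (𝓕 : Set (Fn R)) :
    Set (Fn R) :=
  {F | ∃ S : Set (Fn R), S ⊆ 𝓕 ∪ {EQfn R} ∧ S.Finite ∧
    ∀ ε : ℝ, 0 < ε → ∃ Fhat : FnOn R F.1, PpsRep R S Fhat ∧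
      ∀ x : Fin F.1 → Bool, dist (Fhat x) (F.2 x) < ε}

/-- A nonnegative function on `{0,1}^n` is log-supermodular (lsm) if
`F(x ∨ y) · F(x ∧ y) ≥ F(x) · F(y)` for all `x, y`, with `∨, ∧` componentwise. -/
def IsLSM {n : ℕ} (F : FnOn ℝ≥0 n) : Prop :=
  ∀ x y : Fin n → Bool, F x * F y ≤ F (x ⊔ y) * F (x ⊓ y)

/-- `LSM_k`: the log-supermodular functions of arity `k`. -/
def LSMk (k : ℕ) : Set (Fn ℝ≥0) := {F | F.1 = k ∧ IsLSM F.2}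

/-- The Fourier transform of `F : {0,1}^n → ℝ`:
`F̂(y) = 2⁻ⁿ Σ_w (−1)^{|w ∧ y|} F(w)`, where `|w ∧ y|` counts the coordinates where
both `w` and `y` are `1`. -/
noncomputable def bfourier {n : ℕ} (F : (Fin n → Bool) → ℝ) : (Fin n → Bool) → ℝ :=
  fun y => (2 ^ n : ℝ)⁻¹ *
    ∑ w : Fin n → Bool,
      (-1 : ℝ) ^ (Finset.univ.filter fun i => w i = true ∧ y i = true).card * F w

/-- `G⋆(x) = G(x) · G(1 − x₁, …, 1 − x_k)`, as a real-valued function. -/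
noncomputable def starFn {k : ℕ} (G : FnOn ℝ≥0 k) : (Fin k → Bool) → ℝ :=
  fun x => (G x : ℝ) * (G (fun i => !(x i)) : ℝ)

/-- The arity-4 function taking value `4` on inputs of Hamming weight `4`, value `2` on
inputs of weight `3`, and `1` otherwise. -/
def F17 : FnOn ℝ≥0 4 := fun x =>
  if (Finset.univ.filter fun i => x i = true).card = 4 then 4
  else if (Finset.univ.filter fun i => x i = true).card = 3 then 2 else 1

/-- Functions `t : {0,1}² → ℝ` with `t(0,0), t(1,1) ≥ 0` and `|t(1,0)| ≤ t(0,1)`, equivalently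
the nonnegative combinations of the two diagonal point indicators, the indicator `s` of
`u ≠ u'` and the function `(-1)^u s(u,u')`. -/
def pairMonoid : Submonoid (Bool → Bool → ℝ) where
  carrier := {t | 0 ≤ t false false ∧ 0 ≤ t true true ∧ |t true false| ≤ t false true}
  one_mem' := by simp
  mul_mem' := by
    rintro s t ⟨h₁, h₂, h₃⟩ ⟨k₁, k₂, k₃⟩
    refine ⟨mul_nonneg h₁ k₁, mul_nonneg h₂ k₂, ?_⟩
    simp only [Pi.mul_apply, abs_mul]
    exact mul_le_mul h₃ k₃ (abs_nonneg _) ((abs_nonneg _).trans h₃)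

theorem mem_pairMonoid {t : Bool → Bool → ℝ} : t ∈ pairMonoid ↔
    0 ≤ t false false ∧ 0 ≤ t true true ∧ |t true false| ≤ t false true :=
  Iff.rfl

/-- Functions of a pair of assignments that factor over the variables into members of
`pairMonoid`. -/
def productMonoid (V : Type) [Fintype V] : Submonoid ((V → Bool) × (V → Bool) → ℝ) where
  carrier := {H | ∃ t : V → Bool → Bool → ℝ, (∀ v, t v ∈ pairMonoid) ∧
    ∀ p, H p = ∏ v, t v (p.1 v) (p.2 v)}
  one_mem' := ⟨fun _ => 1, fun _ => one_mem _, fun p => by simp⟩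
  mul_mem' := by
    rintro _ _ ⟨s, hs, hs'⟩ ⟨t, ht, ht'⟩
    refine ⟨fun v => s v * t v, fun v => mul_mem (hs v) (ht v), fun p => ?_⟩
    simp [hs', ht', Finset.prod_mul_distrib]

/-- Finite sums of members of `productMonoid`. -/
def productCone (V : Type) [Fintype V] : Subsemiring ((V → Bool) × (V → Bool) → ℝ) :=
  (productMonoid V).subsemiringClosure

theorem pair_mem_productCone {V : Type} [Fintype V] (v : V) {t : Bool → Bool → ℝ}
    (ht : t ∈ pairMonoid) :
    (fun p : (V → Bool) × (V → Bool) => t (p.1 v) (p.2 v)) ∈ productCone V := by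
  classical
  rw [productCone, ← SetLike.mem_coe, Submonoid.subsemiringClosure_coe]
  refine AddSubmonoid.subset_closure ⟨fun w => if w = v then t else 1, fun w => ?_, fun p => ?_⟩
  · dsimp only
    split_ifs
    exacts [ht, one_mem _]
  · rw [Finset.prod_eq_single v] <;> simp +contextual

/-- A binary log-supermodular function, evaluated on a pair of assignments, is in the cone. -/
theorem lsm_mul_mem_productCone {V : Type} [Fintype V] {G : FnOn ℝ≥0 2} (hG : IsLSM G)
    (σ : Fin 2 → V) :
    (fun p : (V → Bool) × (V → Bool) =>
      (G (fun i => p.1 (σ i)) : ℝ) * G (fun i => p.2 (σ i))) ∈ productCone V := by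
  let g : Bool → Bool → ℝ := fun a b => G ![a, b]
  have g_nonneg (a b) : 0 ≤ g a b := NNReal.coe_nonneg _
  have g_lsm : g false true * g true false ≤ g true true * g false false := by
    have h := hG ![false, true] ![true, false]
    have h₁ : (![false, true] ⊔ ![true, false] : Fin 2 → Bool) = ![true, true] := by decide
    have h₂ : (![false, true] ⊓ ![true, false] : Fin 2 → Bool) = ![false, false] := by decide
    rw [h₁, h₂] at h
    exact_mod_cast h
  have hg (x : V → Bool) : (G (fun i => x (σ i)) : ℝ) = g (x (σ 0)) (x (σ 1)) := by
    have : (fun i => x (σ i)) = ![x (σ 0), x (σ 1)] := by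
      funext i
      fin_cases i <;> rfl
    simp only [g, this]
  let point (c : Bool) : Bool → Bool → ℝ := fun a a' => if a = c ∧ a' = c then 1 else 0
  let row (c : Bool) : Bool → Bool → ℝ := fun b b' => g c b * g c b'
  let diag : Bool → Bool → ℝ := fun b b' => if b = b' then g false b * g true b else 0
  let neq (r : ℝ) : Bool → Bool → ℝ := fun a a' => if a = a' then 0 else r
  let sgn (r : ℝ) : Bool → Bool → ℝ :=
    fun a a' => if a = a' then 0 else if a then -r else r
  have hpoint (c) : point c ∈ pairMonoid := by cases c <;> simp [mem_pairMonoid, point]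
  have hrow (c) : row c ∈ pairMonoid := by
    refine ⟨mul_nonneg (g_nonneg _ _) (g_nonneg _ _), mul_nonneg (g_nonneg _ _) (g_nonneg _ _), ?_⟩
    simp only [row]
    rw [abs_of_nonneg (mul_nonneg (g_nonneg _ _) (g_nonneg _ _)), mul_comm]
  have hdiag : diag ∈ pairMonoid := by
    simp [mem_pairMonoid, diag, mul_nonneg, g_nonneg]
  have hneq {r : ℝ} (hr : 0 ≤ r) : neq r ∈ pairMonoid := by
    simp [mem_pairMonoid, neq, abs_of_nonneg hr]
  have hsgn {r : ℝ} (hr : 0 ≤ r) : sgn r ∈ pairMonoid := by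
    simp [mem_pairMonoid, sgn, abs_of_nonneg hr]
  have hsum : 0 ≤ (g true true * g false false + g false true * g true false) / 2 := by
    have := mul_nonneg (g_nonneg false true) (g_nonneg true false)
    linarith
  have hdiff : 0 ≤ (g true true * g false false - g false true * g true false) / 2 := by
    linarith
  have key := add_mem (add_mem (add_mem (add_mem
    (mul_mem (pair_mem_productCone (σ 0) (hpoint false)) (pair_mem_productCone (σ 1) (hrow false)))
    (mul_mem (pair_mem_productCone (σ 0) (hpoint true)) (pair_mem_productCone (σ 1) (hrow true))))
    (mul_mem (pair_mem_productCone (σ 0) (hneq zero_le_one))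
      (pair_mem_productCone (σ 1) hdiag)))
    (mul_mem (pair_mem_productCone (σ 0) (hneq hsum))
      (pair_mem_productCone (σ 1) (hneq zero_le_one))))
    (mul_mem (pair_mem_productCone (σ 0) (hsgn hdiff))
      (pair_mem_productCone (σ 1) (hsgn zero_le_one)))
  convert key using 1
  funext p
  simp only [hg, Pi.add_apply, Pi.mul_apply]
  cases p.1 (σ 0) <;> cases p.2 (σ 0) <;> cases p.1 (σ 1) <;> cases p.2 (σ 1) <;>
    simp [point, row, diag, neq, sgn] <;> ring

theorem sum_prod_apply {n : ℕ} (f : Fin n → Bool → ℝ) :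
    ∑ x : Fin n → Bool, ∏ i, f i (x i) = ∏ i, ∑ b, f i b := by
  rw [Finset.prod_univ_sum, Fintype.piFinset_univ]

theorem signed_sum_nonneg {n m : ℕ} {H : (Fin (n + m) → Bool) × (Fin (n + m) → Bool) → ℝ}
    (hH : H ∈ productCone (Fin (n + m))) :
    0 ≤ ∑ x : Fin n → Bool, (∏ i, if x i then (-1 : ℝ) else 1) *
      ∑ y : Fin m → Bool, ∑ y' : Fin m → Bool,
        H (Fin.append x y, Fin.append (fun i => !(x i)) y') := by
  rw [productCone, ← SetLike.mem_coe, Submonoid.subsemiringClosure_coe] at hH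
  induction hH using AddSubmonoid.closure_induction with
  | zero => simp
  | add H K _ _ hH hK =>
    simpa only [Pi.add_apply, Finset.sum_add_distrib, mul_add] using add_nonneg hH hK
  | mem H hH =>
    obtain ⟨t, ht, hH⟩ := hH
    have hinner (x : Fin n → Bool) :
        ∑ y : Fin m → Bool, ∑ y' : Fin m → Bool,
          H (Fin.append x y, Fin.append (fun i => !(x i)) y') =
        (∏ i, t (Fin.castAdd m i) (x i) (!(x i))) *
          ∏ k, ∑ a, ∑ b, t (Fin.natAdd n k) a b := by
      simp only [hH, Fin.prod_univ_add, Fin.append_left, Fin.append_right, ← Finset.mul_sum]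
      congr 1
      rw [← sum_prod_apply]
      refine Finset.sum_congr rfl fun y _ => ?_
      exact sum_prod_apply fun k b => t (Fin.natAdd n k) (y k) b
    simp only [hinner, ← mul_assoc, ← Finset.prod_mul_distrib, ← Finset.sum_mul]
    rw [sum_prod_apply fun i b => (if b then (-1 : ℝ) else 1) * t (Fin.castAdd m i) b (!b)]
    refine mul_nonneg (Finset.prod_nonneg fun i _ => ?_) (Finset.prod_nonneg fun k _ => ?_)
    · have h := abs_le.1 (ht (Fin.castAdd m i)).2.2
      simp only [Fintype.sum_bool, if_true, Bool.not_true, Bool.not_false, Bool.false_eq_true,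
        if_false]
      linarith
    · obtain ⟨h₁, h₂, h₃⟩ := ht (Fin.natAdd n k)
      have h := abs_le.1 h₃
      simp only [Fintype.sum_bool]
      linarith

theorem bfourier_starFn_true {n : ℕ} (F : FnOn ℝ≥0 n) :
    bfourier (starFn F) (fun _ => true) = (2 ^ n : ℝ)⁻¹ *
      ∑ x : Fin n → Bool, (∏ i, if x i then (-1 : ℝ) else 1) *
        ((F x : ℝ) * F (fun i => !(x i))) := by
  simp [bfourier, starFn, Finset.prod_ite]

theorem PpsRep.bfourier_starFn_nonneg {n : ℕ} {F : FnOn ℝ≥0 n} {S : Set (Fn ℝ≥0)}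
    (hS : S ⊆ LSMk 2) (hF : PpsRep ℝ≥0 S F) :
    0 ≤ bfourier (starFn F) (fun _ => true) := by
  obtain ⟨m, s, G, σ, hG, hF⟩ := hF
  have hmem : (∏ j, fun p : (Fin (n + m) → Bool) × (Fin (n + m) → Bool) =>
      ((G j).2 (fun i => p.1 (σ j i)) : ℝ) * (G j).2 (fun i => p.2 (σ j i))) ∈
      productCone (Fin (n + m)) := by
    refine prod_mem fun j _ => ?_
    have h := hS (hG j)
    revert h
    generalize σ j = τ
    revert τ
    generalize G j = K
    obtain ⟨k, K⟩ := K
    rintro τ ⟨h₁, h₂⟩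
    dsimp only at h₁
    subst h₁
    exact lsm_mul_mem_productCone h₂ τ
  rw [bfourier_starFn_true]
  refine mul_nonneg (by positivity) ((signed_sum_nonneg hmem).trans_eq ?_)
  refine Finset.sum_congr rfl fun x _ => ?_
  congr 1
  simp only [hF, Finset.prod_apply, NNReal.coe_sum, NNReal.coe_prod, Finset.sum_mul_sum,
    Finset.prod_mul_distrib]

theorem bfourier_starFn_nonneg_of_mem_cloneOmega {F : Fn ℝ≥0} {𝓕 : Set (Fn ℝ≥0)}
    (h𝓕 : 𝓕 ∪ {EQfn ℝ≥0} ⊆ LSMk 2) (hF : F ∈ CloneOmega ℝ≥0 𝓕) :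
    0 ≤ bfourier (starFn F.2) (fun _ => true) := by
  obtain ⟨S, hS, -, happrox⟩ := hF
  have hclosed : IsClosed {F' : FnOn ℝ≥0 F.1 | 0 ≤ bfourier (starFn F') (fun _ => true)} := by
    refine isClosed_le continuous_const ?_
    unfold bfourier starFn
    fun_prop
  refine hclosed.closure_subset (Metric.mem_closure_iff.2 fun ε hε => ?_)
  obtain ⟨F', hF', hdist⟩ := happrox ε hε
  refine ⟨F', hF'.bfourier_starFn_nonneg (hS.trans h𝓕), ?_⟩
  rw [dist_comm]
  exact (dist_pi_lt_iff hε).2 hdist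

theorem eqfn_mem_lsmk_two : EQfn ℝ≥0 ∈ LSMk 2 := by
  refine ⟨rfl, fun (x y : Fin 2 → Bool) => ?_⟩
  change (if x 0 = x 1 then 1 else 0) * (if y 0 = y 1 then 1 else 0) ≤
    (if (x ⊔ y) 0 = (x ⊔ y) 1 then 1 else 0) * (if (x ⊓ y) 0 = (x ⊓ y) 1 then (1 : ℝ≥0) else 0)
  by_cases hx : x 0 = x 1 <;> by_cases hy : y 0 = y 1 <;> simp [hx, hy]

/-- Regard a function as one of arity `4`, by adding fictitious arguments when its arity
is less than `4`. -/
def padFour (G : Fn ℝ≥0) : Fn ℝ≥0 :=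
  ⟨4, fun x => G.2 fun i => x (Fin.ofNat 4 i)⟩

theorem padFour_mem_lsmk {k : ℕ} {G : Fn ℝ≥0} (hG : G ∈ LSMk k) : padFour G ∈ LSMk 4 :=
  ⟨rfl, fun x y => hG.2 (fun i => x (Fin.ofNat 4 i)) fun i => y (Fin.ofNat 4 i)⟩

theorem PpsRep.image_padFour {n : ℕ} {F : FnOn ℝ≥0 n} {S : Set (Fn ℝ≥0)}
    (hS : S ⊆ LSMk 2) (hF : PpsRep ℝ≥0 S F) : PpsRep ℝ≥0 (padFour '' S) F := by
  obtain ⟨m, s, G, σ, hG, hF⟩ := hF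
  have harity (j) : (G j).1 = 2 := (hS (hG j)).1
  refine ⟨m, s, fun j => padFour (G j),
    fun j (i : Fin 4) => σ j ⟨i % 2, by rw [harity j]; omega⟩,
    fun j => Set.mem_image_of_mem _ (hG j), fun x => ?_⟩
  rw [hF]
  refine Finset.sum_congr rfl fun y _ => Finset.prod_congr rfl fun j _ => ?_
  refine congrArg (G j).2 (funext fun i => ?_)
  have hi : (i : ℕ) < 2 := (harity j) ▸ i.2
  congr 2
  ext
  simp only [Fin.val_ofNat]
  omega

theorem cloneOmega_lsmk_two_subset_four :
    CloneOmega ℝ≥0 (LSMk 2) ⊆ CloneOmega ℝ≥0 (LSMk 4) := by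
  rintro F ⟨S, hS, hfin, happrox⟩
  have hS' : S ⊆ LSMk 2 :=
    hS.trans (Set.union_subset subset_rfl (Set.singleton_subset_iff.2 eqfn_mem_lsmk_two))
  refine ⟨padFour '' S, ?_, hfin.image _, fun ε hε => ?_⟩
  · rintro _ ⟨G, hG, rfl⟩
    exact Or.inl (padFour_mem_lsmk (hS' hG))
  · obtain ⟨F', hF', hdist⟩ := happrox ε hε
    exact ⟨F', hF'.image_padFour hS', hdist⟩

theorem mem_cloneOmega_of_mem {F : Fn ℝ≥0} {𝓕 : Set (Fn ℝ≥0)} (hF : F ∈ 𝓕) :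
    F ∈ CloneOmega ℝ≥0 𝓕 := by
  refine ⟨{F}, Set.singleton_subset_iff.2 (Or.inl hF), Set.finite_singleton F, fun ε hε =>
    ⟨F.2, ⟨0, 1, fun _ => F, fun _ => Fin.castAdd 0, fun _ => rfl, fun x => ?_⟩,
      fun x => by simpa using hε⟩⟩
  simp only [Finset.univ_unique, Finset.prod_singleton, Finset.sum_singleton]
  exact congrArg F.2 (funext fun i => (Fin.append_left x _ i).symm)

/-- `F17` with values in the natural numbers. -/
def natF17 (x : Fin 4 → Bool) : ℕ :=
  if (Finset.univ.filter fun i => x i = true).card = 4 then 4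
  else if (Finset.univ.filter fun i => x i = true).card = 3 then 2 else 1

theorem F17_eq_natCast (x : Fin 4 → Bool) : F17 x = natF17 x := by
  unfold F17 natF17
  split_ifs <;> norm_num

theorem isLSM_F17 : IsLSM F17 := by
  have h : ∀ x y, natF17 x * natF17 y ≤ natF17 (x ⊔ y) * natF17 (x ⊓ y) := by
    decide +kernel
  intro x y
  simp only [F17_eq_natCast]
  exact_mod_cast h x y

theorem bfourier_starFn_F17 : bfourier (starFn F17) (fun _ => true) = -(1 / 8 : ℝ) := by
  have h : ∑ x : Fin 4 → Bool, (∏ i, if x i then (-1 : ℤ) else 1) *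
      ((natF17 x : ℤ) * natF17 (fun i => !(x i))) = -2 := by
    decide +kernel
  have h' := congrArg (Int.cast : ℤ → ℝ) h
  push_cast at h'
  rw [bfourier_starFn_true]
  simp only [F17_eq_natCast, NNReal.coe_natCast]
  rw [h']
  norm_num

/-- Lemma: `F17` is log-supermodular, the Fourier coefficient of `F17⋆` at `(1,1,1,1)`
equals `−1/8 < 0`, and consequently `⟨LSM₂⟩_ω ⊊ ⟨LSM₄⟩_ω`. -/
theorem lsm2_ssubset_lsm4 :
    IsLSM F17 ∧
    bfourier (starFn F17) (fun _ => true) = -(1 / 8 : ℝ) ∧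
    CloneOmega ℝ≥0 (LSMk 2) ⊂ CloneOmega ℝ≥0 (LSMk 4) := by
  refine ⟨isLSM_F17, bfourier_starFn_F17, cloneOmega_lsmk_two_subset_four, fun hsub => ?_⟩
  have hmem : (⟨4, F17⟩ : Fn ℝ≥0) ∈ CloneOmega ℝ≥0 (LSMk 2) :=
    hsub (mem_cloneOmega_of_mem ⟨rfl, isLSM_F17⟩)
  have h := bfourier_starFn_nonneg_of_mem_cloneOmega
    (Set.union_subset subset_rfl (Set.singleton_subset_iff.2 eqfn_mem_lsmk_two)) hmem
  rw [bfourier_starFn_F17] at h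
  norm_num at h
end

section
/- Let ⊕₃ : {0,1}³ → {0,1} be the relation {(0,0,0),(0,1,1),(1,0,1),(1,1,0)} (viewed as a 0/1-valued function: ⊕₃(x,y,z) = 1 iff x⊕y⊕z = 0), and let ℬ₁^down denote the set of unary functions U : {0,1} → ℝ≥0 with U(1) ≤ U(0). Then ⊕₃ ∉ ⟨IMP, ℬ₁^down⟩_ω and IMP ∉ ⟨⊕₃, ℬ₁^down⟩_ω. -/
open scoped NNReal BigOperators

/-- `IMP(x,y) = 0` if `(x,y) = (1,0)`, and `1` otherwise. -/
def IMPfn : Fn ℝ≥0 := ⟨2, fun x => if x 0 = true ∧ x 1 = false then 0 else 1⟩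

/-- `NEQ(x,y) = 1` iff `x ≠ y`, else `0`. -/
def NEQfn : Fn ℝ≥0 := ⟨2, fun x => if x 0 ≠ x 1 then 1 else 0⟩

/-- `OR(x,y) = 0` if `(x,y) = (0,0)`, and `1` otherwise. -/
def ORfn : Fn ℝ≥0 := ⟨2, fun x => if x 0 = false ∧ x 1 = false then 0 else 1⟩

/-- `ℬ₁`: the set of all unary functions `{0,1} → ℝ≥0`. -/
def unaryFns : Set (Fn ℝ≥0) := {F | F.1 = 1}

/-- `ℬ₁^down`: the unary functions `U` with `U(1) ≤ U(0)`. -/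
def B1down : Set (Fn ℝ≥0) :=
  {F | ∃ U : FnOn ℝ≥0 1, U (fun _ => true) ≤ U (fun _ => false) ∧ F = ⟨1, U⟩}

/-- `⊕₃`: the ternary even-parity relation, as a 0/1-valued function. -/
def Oplus3fn : Fn ℝ≥0 :=
  ⟨3, fun x => if xor (x 0) (xor (x 1) (x 2)) = false then 1 else 0⟩

/-- `F (x) F (y) ≤ F (x ⊓ y) F (x ⊔ y)` for all `x`, `y`. -/
def LogSupermodular {α : Type*} [Lattice α] (F : α → ℝ≥0) : Prop :=
  ∀ x y, F x * F y ≤ F (x ⊓ y) * F (x ⊔ y)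

theorem LogSupermodular.prod {α κ : Type*} [Lattice α] [Fintype κ] {F : κ → α → ℝ≥0}
    (h : ∀ j, LogSupermodular (F j)) : LogSupermodular fun x => ∏ j, F j x := by
  intro x y
  simp only [← Finset.prod_mul_distrib]
  exact Finset.prod_le_prod' fun j _ => h j x y

theorem Fin.append_inf {n m : ℕ} (x x' : Fin n → Bool) (y y' : Fin m → Bool) :
    Fin.append (x ⊓ x') (y ⊓ y') = Fin.append x y ⊓ Fin.append x' y' := by
  ext i
  refine Fin.addCases (fun i => ?_) (fun i => ?_) i <;> simp

theorem Fin.append_sup {n m : ℕ} (x x' : Fin n → Bool) (y y' : Fin m → Bool) :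
    Fin.append (x ⊔ x') (y ⊔ y') = Fin.append x y ⊔ Fin.append x' y' := by
  ext i
  refine Fin.addCases (fun i => ?_) (fun i => ?_) i <;> simp

/-- Log-supermodularity is inherited by pps-formulas, by the four functions theorem. -/
theorem PpsRep.logSupermodular {S : Set (Fn ℝ≥0)} {n : ℕ} {F : FnOn ℝ≥0 n}
    (hF : PpsRep ℝ≥0 S F) (hS : ∀ G ∈ S, LogSupermodular G.2) : LogSupermodular F := by
  obtain ⟨m, s, G, σ, hG, hF⟩ := hF
  have key : LogSupermodular fun z : Fin (n + m) → Bool => ∏ j, (G j).2 fun i => z (σ j i) :=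
    .prod fun j x y => hS (G j) (hG j) (fun i => x (σ j i)) (fun i => y (σ j i))
  intro x x'
  simp only [hF]
  refine four_functions_theorem_univ _ _ _ _ (fun _ => zero_le) (fun _ => zero_le)
    (fun _ => zero_le) (fun _ => zero_le) fun y y' => ?_
  simp only [Fin.append_inf, Fin.append_sup]
  exact key (Fin.append x y) (Fin.append x' y')

theorem logSupermodular_EQfn : LogSupermodular (EQfn ℝ≥0).2 := by
  change LogSupermodular fun x : Fin 2 → Bool => if x 0 = x 1 then (1 : ℝ≥0) else 0
  intro x y
  simp only [Pi.inf_apply, Pi.sup_apply]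
  rcases Bool.eq_false_or_eq_true (x 0) with hx₀ | hx₀ <;>
  rcases Bool.eq_false_or_eq_true (x 1) with hx₁ | hx₁ <;>
  rcases Bool.eq_false_or_eq_true (y 0) with hy₀ | hy₀ <;>
  rcases Bool.eq_false_or_eq_true (y 1) with hy₁ | hy₁ <;>
  simp [hx₀, hx₁, hy₀, hy₁]

theorem logSupermodular_IMPfn : LogSupermodular IMPfn.2 := by
  change LogSupermodular fun x : Fin 2 → Bool =>
    if x 0 = true ∧ x 1 = false then (0 : ℝ≥0) else 1
  intro x y
  simp only [Pi.inf_apply, Pi.sup_apply]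
  rcases Bool.eq_false_or_eq_true (x 0) with hx₀ | hx₀ <;>
  rcases Bool.eq_false_or_eq_true (x 1) with hx₁ | hx₁ <;>
  rcases Bool.eq_false_or_eq_true (y 0) with hy₀ | hy₀ <;>
  rcases Bool.eq_false_or_eq_true (y 1) with hy₁ | hy₁ <;>
  simp [hx₀, hx₁, hy₀, hy₁]

theorem logSupermodular_unary (U : FnOn ℝ≥0 1) : LogSupermodular U := by
  intro x y
  have htotal : x ≤ y ∨ y ≤ x := by
    simpa only [Pi.le_def, Fin.forall_fin_one] using le_total (x 0) (y 0)
  rcases htotal with h | h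
  · rw [inf_eq_left.2 h, sup_eq_right.2 h]
  · rw [inf_eq_right.2 h, sup_eq_left.2 h, mul_comm]

theorem logSupermodular_of_mem_imp {G : Fn ℝ≥0}
    (hG : G ∈ ({IMPfn} ∪ B1down) ∪ {EQfn ℝ≥0}) : LogSupermodular G.2 := by
  rcases hG with (rfl | ⟨U, -, rfl⟩) | rfl
  · exact logSupermodular_IMPfn
  · exact logSupermodular_unary U
  · exact logSupermodular_EQfn

/-- The nontrivial character of `{0,1}`, with values in `ℝ`. -/
def boolSign (b : Bool) : ℝ := if b then -1 else 1

/-- All Fourier coefficients of `H` are nonnegative; the characters are written as products of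
powers of the coordinate characters. -/
def FourierNonneg {ι : Type*} [Fintype ι] [DecidableEq ι] (H : (ι → Bool) → ℝ) : Prop :=
  ∀ c : ι → ℕ, 0 ≤ ∑ x, (∏ i, boolSign (x i) ^ c i) * H x

theorem fourierNonneg_one {ι : Type*} [Fintype ι] [DecidableEq ι] :
    FourierNonneg (1 : (ι → Bool) → ℝ) := by
  intro c
  simp only [Pi.one_apply, mul_one]
  rw [← Fintype.prod_sum fun i b => boolSign b ^ c i]
  refine Finset.prod_nonneg fun i _ => ?_
  rcases neg_one_pow_eq_or ℝ (c i) with h | h <;> simp [boolSign, h]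

theorem FourierNonneg.sign_mul {ι : Type*} [Fintype ι] [DecidableEq ι] {H : (ι → Bool) → ℝ}
    (hH : FourierNonneg H) (j : ι) : FourierNonneg ((fun x => boolSign (x j)) * H) := by
  intro c
  convert hH (c + Pi.single j 1) using 2 with x
  simp only [Pi.add_apply, pow_add, Finset.prod_mul_distrib, Pi.mul_apply, mul_assoc]
  congr 2
  rw [Finset.prod_eq_single j] <;> simp +contextual

/-- The functions whose product with any function with nonnegative Fourier coefficients again has
nonnegative Fourier coefficients. -/
def positiveDefinite (ι : Type*) [Fintype ι] [DecidableEq ι] : Subsemiring ((ι → Bool) → ℝ) where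
  carrier := {h | ∀ H, FourierNonneg H → FourierNonneg (h * H)}
  mul_mem' ha hb H hH := by
    rw [mul_assoc]
    exact ha _ (hb _ hH)
  one_mem' H hH := by rwa [one_mul]
  add_mem' ha hb H hH c := by
    simpa only [add_mul, Pi.add_apply, mul_add, Finset.sum_add_distrib]
      using add_nonneg (ha H hH c) (hb H hH c)
  zero_mem' H _ c := by simp

section

variable {ι : Type*} [Fintype ι] [DecidableEq ι]

theorem sign_mem_positiveDefinite (j : ι) :
    (fun x => boolSign (x j)) ∈ positiveDefinite ι :=
  fun _ hH => hH.sign_mul j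

theorem const_mem_positiveDefinite {a : ℝ} (ha : 0 ≤ a) :
    (fun _ => a) ∈ positiveDefinite ι := by
  intro H hH c
  simp only [Pi.mul_apply, mul_left_comm _ a, ← Finset.mul_sum]
  exact mul_nonneg ha (hH c)

theorem sum_nonneg_of_mem_positiveDefinite {h : (ι → Bool) → ℝ}
    (hh : h ∈ positiveDefinite ι) : 0 ≤ ∑ x, h x := by
  simpa using hh 1 fourierNonneg_one 0

end

/-- Every substitution instance of `G` is positive definite. -/
def SubstPositiveDefinite (G : Fn ℝ≥0) : Prop :=
  ∀ (N : ℕ) (σ : Fin G.1 → Fin N),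
    (fun z : Fin N → Bool => (G.2 fun i => z (σ i) : ℝ)) ∈ positiveDefinite (Fin N)

theorem substPositiveDefinite_EQfn : SubstPositiveDefinite (EQfn ℝ≥0) := by
  intro N (σ : Fin 2 → Fin N)
  have h := mul_mem (const_mem_positiveDefinite (ι := Fin N) (a := 1 / 2) (by norm_num))
    (add_mem (one_mem _)
      (mul_mem (sign_mem_positiveDefinite (σ 0)) (sign_mem_positiveDefinite (σ 1))))
  convert h using 1
  funext z
  simp only [EQfn, boolSign, Pi.mul_apply, Pi.add_apply, Pi.one_apply]
  rcases Bool.eq_false_or_eq_true (z (σ 0)) with h₀ | h₀ <;>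
  rcases Bool.eq_false_or_eq_true (z (σ 1)) with h₁ | h₁ <;>
  norm_num [h₀, h₁]

theorem substPositiveDefinite_Oplus3fn : SubstPositiveDefinite Oplus3fn := by
  intro N (σ : Fin 3 → Fin N)
  have h := mul_mem (const_mem_positiveDefinite (ι := Fin N) (a := 1 / 2) (by norm_num))
    (add_mem (one_mem _) (mul_mem (sign_mem_positiveDefinite (σ 0))
      (mul_mem (sign_mem_positiveDefinite (σ 1)) (sign_mem_positiveDefinite (σ 2)))))
  convert h using 1
  funext z
  simp only [Oplus3fn, boolSign, Pi.mul_apply, Pi.add_apply, Pi.one_apply]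
  rcases Bool.eq_false_or_eq_true (z (σ 0)) with h₀ | h₀ <;>
  rcases Bool.eq_false_or_eq_true (z (σ 1)) with h₁ | h₁ <;>
  rcases Bool.eq_false_or_eq_true (z (σ 2)) with h₂ | h₂ <;>
  norm_num [h₀, h₁, h₂]

theorem substPositiveDefinite_unary {U : FnOn ℝ≥0 1}
    (hU : U (fun _ => true) ≤ U (fun _ => false)) : SubstPositiveDefinite ⟨1, U⟩ := by
  intro N (σ : Fin 1 → Fin N)
  have hU' : (U (fun _ => true) : ℝ) ≤ U (fun _ => false) := NNReal.coe_le_coe.2 hU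
  have h := add_mem
    (const_mem_positiveDefinite (ι := Fin N)
      (a := (U (fun _ => false) + U (fun _ => true)) / 2) (by positivity))
    (mul_mem (const_mem_positiveDefinite (ι := Fin N)
        (a := (U (fun _ => false) - U (fun _ => true)) / 2) (by linarith))
      (sign_mem_positiveDefinite (σ 0)))
  convert h using 1
  funext z
  have hz : (fun i => z (σ i)) = fun _ => z (σ 0) := funext fun i => by rw [Subsingleton.elim i 0]
  simp only [hz, boolSign, Pi.mul_apply, Pi.add_apply]
  cases z (σ 0) <;> simp <;> ring

theorem substPositiveDefinite_of_mem_oplus {G : Fn ℝ≥0}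
    (hG : G ∈ ({Oplus3fn} ∪ B1down) ∪ {EQfn ℝ≥0}) : SubstPositiveDefinite G := by
  rcases hG with (rfl | ⟨U, hU, rfl⟩) | rfl
  · exact substPositiveDefinite_Oplus3fn
  · exact substPositiveDefinite_unary hU
  · exact substPositiveDefinite_EQfn

/-- The degree-one Fourier coefficients of a pps-formula over positive definite functions are
nonnegative. -/
theorem PpsRep.sum_sign_mul_nonneg {S : Set (Fn ℝ≥0)} {n : ℕ} {F : FnOn ℝ≥0 n}
    (hF : PpsRep ℝ≥0 S F) (hS : ∀ G ∈ S, SubstPositiveDefinite G) (k : Fin n) :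
    0 ≤ ∑ x, boolSign (x k) * (F x : ℝ) := by
  obtain ⟨m, s, G, σ, hG, hF⟩ := hF
  have key := sum_nonneg_of_mem_positiveDefinite
    (mul_mem (sign_mem_positiveDefinite (Fin.castAdd m k))
      (prod_mem (t := Finset.univ) fun j _ => hS (G j) (hG j) (n + m) (σ j)))
  rw [← (Fin.appendEquiv n m).sum_comp, Fintype.sum_prod_type] at key
  convert key using 2 with x
  simp [hF, Fin.appendEquiv, Finset.mul_sum]

/-- Lemma: `⊕₃ ∉ ⟨IMP, ℬ₁^down⟩_ω` and `IMP ∉ ⟨⊕₃, ℬ₁^down⟩_ω`. -/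
theorem oplus_imp_not_definable :
    Oplus3fn ∉ CloneOmega ℝ≥0 ({IMPfn} ∪ B1down) ∧
    IMPfn ∉ CloneOmega ℝ≥0 ({Oplus3fn} ∪ B1down) := by
  constructor
  · rintro ⟨S, hS, -, happ⟩
    obtain ⟨(F : FnOn ℝ≥0 3), (hF : PpsRep ℝ≥0 S (n := 3) F),
      (hdist : ∀ x : Fin 3 → Bool, _)⟩ := happ (1 / 4) (by norm_num)
    have hlsm : LogSupermodular F :=
      hF.logSupermodular fun G hG => logSupermodular_of_mem_imp (hS hG)
    have h := hlsm ![false, true, true] ![true, false, true]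
    have hmeet : (![false, true, true] ⊓ ![true, false, true] : Fin 3 → Bool)
        = ![false, false, true] := by decide
    have hjoin : (![false, true, true] ⊔ ![true, false, true] : Fin 3 → Bool)
        = ![true, true, true] := by decide
    have h₁ := hdist ![false, true, true]
    have h₂ := hdist ![true, false, true]
    have h₃ := hdist ![false, false, true]
    have h₄ := hdist ![true, true, true]
    rw [hmeet, hjoin] at h
    simp [Oplus3fn, NNReal.dist_eq, abs_lt] at h₁ h₂ h₃ h₄
    have h' := NNReal.coe_le_coe.2 h
    push_cast at h'
    nlinarith [NNReal.coe_nonneg (F ![false, false, true]),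
      NNReal.coe_nonneg (F ![true, true, true])]
  · rintro ⟨S, hS, -, happ⟩
    obtain ⟨(F : FnOn ℝ≥0 2), (hF : PpsRep ℝ≥0 S (n := 2) F),
      (hdist : ∀ x : Fin 2 → Bool, _)⟩ := happ (1 / 4) (by norm_num)
    have h := hF.sum_sign_mul_nonneg (fun G hG => substPositiveDefinite_of_mem_oplus (hS hG)) 1
    have h₁ := hdist ![false, false]
    have h₂ := hdist ![false, true]
    have h₃ := hdist ![true, false]
    have h₄ := hdist ![true, true]
    rw [← (finTwoArrowEquiv Bool).symm.sum_comp, Fintype.sum_prod_type] at h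
    simp [finTwoArrowEquiv, boolSign] at h
    simp [IMPfn, NNReal.dist_eq, abs_lt] at h₁ h₂ h₃ h₄
    linarith
end
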